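/- arXiv:2603.05943 — 3 statements merged into one kernel-verified Lean document; each statement's English description precedes it below -/
import Mathlib

section
/- In the derivation-type case R = B[X;D] (ρ = id), a monic polynomial f = Σ_{i=0}^{m} X^i a_i of degree m ≥ 1 with fR = Rf is separable in R—equivalently, by Miyashita's criterion, there exists u ∈ V with τ(u) = 1—if and only if the sequence V → V → C(A) → 0, with maps I_x and τ, is exact; that is, if and only if {v ∈ V : τ(v) = 0} = I_x(V) and τ(V) = C(A). -/
open Finset

section SkewPolynomial

variable {B R : Type*} [Ring B] [Ring R] {ι : B →+* R} {X : R} {D : B →+ B}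

/-- The additive subgroup of skew polynomials of degree less than `n`. -/
def degreeLTSubgroup (ι : B →+* R) (X : R) (n : ℕ) : AddSubgroup R :=
  AddSubgroup.closure {r | ∃ i < n, ∃ b, r = X ^ i * ι b}

theorem monomial_mem_degreeLT {i n : ℕ} (h : i < n) (b : B) :
    X ^ i * ι b ∈ degreeLTSubgroup ι X n :=
  AddSubgroup.subset_closure ⟨i, h, b, rfl⟩

theorem degreeLT_induction {n : ℕ} {S : AddSubgroup R} (φ : R →+ R)
    (h : ∀ i < n, ∀ b, φ (X ^ i * ι b) ∈ S) {r : R} (hr : r ∈ degreeLTSubgroup ι X n) :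
    φ r ∈ S := by
  have : degreeLTSubgroup ι X n ≤ S.comap φ := by
    refine (AddSubgroup.closure_le _).2 ?_
    rintro _ ⟨i, hi, b, rfl⟩
    exact h i hi b
  exact this hr

theorem degreeLT_mono {n k : ℕ} (h : n ≤ k) {r : R} (hr : r ∈ degreeLTSubgroup ι X n) :
    r ∈ degreeLTSubgroup ι X k :=
  degreeLT_induction (AddMonoidHom.id R)
    (fun _ hi b => monomial_mem_degreeLT (hi.trans_le h) b) hr

theorem X_pow_mul_mem_degreeLT (k : ℕ) {n : ℕ} {r : R} (hr : r ∈ degreeLTSubgroup ι X n) :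
    X ^ k * r ∈ degreeLTSubgroup ι X (k + n) := by
  refine degreeLT_induction (AddMonoidHom.mulLeft (X ^ k)) (fun i hi b => ?_) hr
  rw [AddMonoidHom.coe_mulLeft, ← mul_assoc, ← pow_add]
  exact monomial_mem_degreeLT (by lia) b

theorem mul_coe_mem_degreeLT {n : ℕ} {r : R} (hr : r ∈ degreeLTSubgroup ι X n) (b : B) :
    r * ι b ∈ degreeLTSubgroup ι X n := by
  refine degreeLT_induction (AddMonoidHom.mulRight (ι b)) (fun i hi c => ?_) hr
  rw [AddMonoidHom.mulRight_apply, mul_assoc, ← map_mul]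
  exact monomial_mem_degreeLT hi _

theorem coe_mul_X_pow_sub_mem_degreeLT
    (hcomm : ∀ α : B, ι α * X = X * ι α + ι (D α)) (k : ℕ) (α : B) :
    ι α * X ^ k - X ^ k * ι α ∈ degreeLTSubgroup ι X k := by
  induction k generalizing α with
  | zero => simp
  | succ k ih =>
    have h : ι α * X ^ (k + 1) - X ^ (k + 1) * ι α =
        X ^ 1 * (ι α * X ^ k - X ^ k * ι α) + (ι (D α) * X ^ k - X ^ k * ι (D α))
          + X ^ k * ι (D α) := by
      rw [pow_succ', ← mul_assoc, hcomm]
      noncomm_ring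
    rw [h]
    refine add_mem (add_mem ?_ (degreeLT_mono k.le_succ (ih _)))
      (monomial_mem_degreeLT k.lt_succ_self _)
    rw [add_comm k 1]
    exact X_pow_mul_mem_degreeLT 1 (ih _)

theorem coe_mul_mem_degreeLT
    (hcomm : ∀ α : B, ι α * X = X * ι α + ι (D α)) {n : ℕ} {r : R}
    (hr : r ∈ degreeLTSubgroup ι X n) (α : B) :
    ι α * r ∈ degreeLTSubgroup ι X n := by
  refine degreeLT_induction (AddMonoidHom.mulLeft (ι α)) (fun i hi b => ?_) hr
  have h : ι α * (X ^ i * ι b) =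
      (ι α * X ^ i - X ^ i * ι α) * ι b + X ^ i * ι (α * b) := by
    rw [map_mul]
    noncomm_ring
  rw [AddMonoidHom.coe_mulLeft, h]
  exact add_mem
    (mul_coe_mem_degreeLT (degreeLT_mono hi.le (coe_mul_X_pow_sub_mem_degreeLT hcomm i α)) b)
    (monomial_mem_degreeLT hi _)

theorem mul_mem_degreeLT
    (hcomm : ∀ α : B, ι α * X = X * ι α + ι (D α)) {k n : ℕ} {r s : R}
    (hr : r ∈ degreeLTSubgroup ι X k) (hs : s ∈ degreeLTSubgroup ι X (n + 1)) :
    r * s ∈ degreeLTSubgroup ι X (k + n) := by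
  refine degreeLT_induction (AddMonoidHom.mulRight s) (fun i hi b => ?_) hr
  rw [AddMonoidHom.mulRight_apply, mul_assoc]
  exact degreeLT_mono (by lia) (X_pow_mul_mem_degreeLT i (coe_mul_mem_degreeLT hcomm hs b))

theorem exists_monomial_add_of_mem_degreeLT_succ {n : ℕ} {r : R}
    (hr : r ∈ degreeLTSubgroup ι X (n + 1)) :
    ∃ c, r - X ^ n * ι c ∈ degreeLTSubgroup ι X n := by
  induction hr using AddSubgroup.closure_induction with
  | mem r h =>
    obtain ⟨i, hi, b, rfl⟩ := h
    rcases Nat.lt_succ_iff_lt_or_eq.1 hi with h | rfl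
    · exact ⟨0, by simpa using monomial_mem_degreeLT h b⟩
    · exact ⟨b, by simp⟩
  | zero => exact ⟨0, by simp⟩
  | add r s _ _ h₁ h₂ =>
    obtain ⟨c, hc⟩ := h₁
    obtain ⟨d, hd⟩ := h₂
    refine ⟨c + d, ?_⟩
    have := add_mem hc hd
    rwa [sub_add_sub_comm, ← mul_add, ← map_add] at this
  | neg r _ h =>
    obtain ⟨c, hc⟩ := h
    refine ⟨-c, ?_⟩
    have := neg_mem hc
    rwa [map_neg, mul_neg, sub_neg_eq_add, neg_add_eq_sub, ← neg_sub]

theorem exists_mem_degreeLT (hfree : ∀ r : R, ∃! c : ℕ →₀ B, r = c.sum fun i b => X ^ i * ι b)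
    (r : R) : ∃ n, r ∈ degreeLTSubgroup ι X n := by
  obtain ⟨c, rfl, -⟩ := hfree r
  refine ⟨c.support.sup id + 1, sum_mem fun i hi => monomial_mem_degreeLT ?_ _⟩
  exact Nat.lt_succ_of_le (Finset.le_sup (f := id) hi)

/-- The coefficients of a skew polynomial, as an additive map. -/
theorem exists_coeff (hfree : ∀ r : R, ∃! c : ℕ →₀ B, r = c.sum fun i b => X ^ i * ι b) :
    ∃ κ : R →+ (ℕ →₀ B), ∀ i b, κ (X ^ i * ι b) = Finsupp.single i b := by
  let L : (ℕ →₀ B) →+ R :=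
    Finsupp.liftAddHom fun i => (AddMonoidHom.mulLeft (X ^ i)).comp ι.toAddMonoidHom
  have hL : ∀ c, L c = c.sum fun i b => X ^ i * ι b := fun c => by
    simp [L, Finsupp.liftAddHom_apply, Function.comp_def]
  have hbij : Function.Bijective L := by
    refine ⟨fun c d h => (hfree (L c)).unique (hL c) (h.trans (hL d)), fun r => ?_⟩
    obtain ⟨c, hc, -⟩ := hfree r
    exact ⟨c, (hL c).trans hc.symm⟩
  refine ⟨(AddEquiv.ofBijective L hbij).symm.toAddMonoidHom, fun i b => ?_⟩
  refine (AddEquiv.symm_apply_eq _).2 ?_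
  simp [hL]

theorem coeff_eq_zero_of_mem_degreeLT {κ : R →+ (ℕ →₀ B)}
    (hκ : ∀ i b, κ (X ^ i * ι b) = Finsupp.single i b) {n : ℕ} {r : R}
    (hr : r ∈ degreeLTSubgroup ι X n) : κ r n = 0 := by
  have : degreeLTSubgroup ι X n ≤ ((Finsupp.applyAddHom n).comp κ).ker := by
    refine (AddSubgroup.closure_le _).2 ?_
    rintro _ ⟨i, hi, b, rfl⟩
    simp [AddMonoidHom.mem_ker, hκ, hi.ne]
  exact this hr

/-- The universal property of the skew polynomial ring of derivation type. -/
theorem exists_skewPolynomial_lift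
    (hcomm : ∀ α : B, ι α * X = X * ι α + ι (D α))
    (hfree : ∀ r : R, ∃! c : ℕ →₀ B, r = c.sum fun i b => X ^ i * ι b)
    {T : Type*} [Ring T] (j : B →+* T) (t : T) (ht : ∀ α, j α * t = t * j α + j (D α)) :
    ∃ Φ : R →+* T, (∀ b, Φ (ι b) = j b) ∧ Φ X = t := by
  obtain ⟨κ, hκ⟩ := exists_coeff hfree
  let φ : R →+ T :=
    (Finsupp.liftAddHom fun i => (AddMonoidHom.mulLeft (t ^ i)).comp j.toAddMonoidHom).comp κ
  have hφ : ∀ i b, φ (X ^ i * ι b) = t ^ i * j b := fun i b => by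
    simp [φ, hκ, Finsupp.liftAddHom_apply]
  have hext : ∀ g h : R →+ T, (∀ i b, g (X ^ i * ι b) = h (X ^ i * ι b)) → ∀ r, g r = h r := by
    intro g h H r
    obtain ⟨c, rfl, -⟩ := hfree r
    simp [Finsupp.sum, H]
  have hX : ∀ r, φ (X * r) = t * φ r :=
    hext (φ.comp (AddMonoidHom.mulLeft X)) ((AddMonoidHom.mulLeft t).comp φ) fun i b => by
      simp [← mul_assoc, ← pow_succ', hφ]
  have hXpow : ∀ i r, φ (X ^ i * r) = t ^ i * φ r := by
    intro i r
    induction i with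
    | zero => simp
    | succ i ih => rw [pow_succ', mul_assoc, hX, ih, pow_succ', mul_assoc]
  have hpow : ∀ i α b, φ (ι α * (X ^ i * ι b)) = j α * (t ^ i * j b) := by
    intro i
    induction i with
    | zero =>
      intro α b
      have := hφ 0 (α * b)
      simpa using this
    | succ i ih =>
      intro α b
      have h : ι α * (X ^ (i + 1) * ι b) =
          X * (ι α * (X ^ i * ι b)) + ι (D α) * (X ^ i * ι b) := by
        rw [pow_succ', mul_assoc, ← mul_assoc, hcomm, add_mul, mul_assoc]
      rw [h, map_add, hX, ih, ih, ← mul_assoc, ← add_mul, ← ht, pow_succ']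
      simp only [mul_assoc]
  have hcoe : ∀ α r, φ (ι α * r) = j α * φ r := fun α =>
    hext (φ.comp (AddMonoidHom.mulLeft (ι α))) ((AddMonoidHom.mulLeft (j α)).comp φ) fun i b => by
      simp [hpow, hφ]
  have hmul : ∀ r s, φ (r * s) = φ r * φ s := fun r s =>
    hext (φ.comp (AddMonoidHom.mulRight s)) ((AddMonoidHom.mulRight (φ s)).comp φ)
      (fun i b => by
        simp only [AddMonoidHom.comp_apply, AddMonoidHom.mulRight_apply, hφ]
        rw [mul_assoc, hXpow, hcoe, mul_assoc]) r
  have hone : φ 1 = 1 := by simpa using hφ 0 1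
  refine ⟨{ φ with map_one' := hone, map_mul' := hmul, map_zero' := φ.map_zero }, ?_, ?_⟩
  · intro b
    simpa using hφ 0 b
  · simpa using hφ 1 1

/-- A monic polynomial of degree `m` is not a left zero divisor, and its nonzero right multiples
have degree at least `m`. -/
theorem eq_zero_of_monic_mul_mem_degreeLT
    (hcomm : ∀ α : B, ι α * X = X * ι α + ι (D α))
    (hfree : ∀ r : R, ∃! c : ℕ →₀ B, r = c.sum fun i b => X ^ i * ι b)
    {m : ℕ} {f s : R} (hf : f - X ^ m ∈ degreeLTSubgroup ι X m)
    (hfs : f * s ∈ degreeLTSubgroup ι X m) : s = 0 := by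
  obtain ⟨κ, hκ⟩ := exists_coeff hfree
  have key : ∀ n, s ∈ degreeLTSubgroup ι X n → s = 0 := by
    intro n
    induction n with
    | zero =>
      intro hs
      simpa [degreeLTSubgroup] using hs
    | succ n ih =>
      intro hs
      obtain ⟨c, hc⟩ := exists_monomial_add_of_mem_degreeLT_succ hs
      have h : X ^ (m + n) * ι c =
          f * s - (f - X ^ m) * s - X ^ m * (s - X ^ n * ι c) := by
        rw [pow_add]
        noncomm_ring
      have hmem : X ^ (m + n) * ι c ∈ degreeLTSubgroup ι X (m + n) := by
        rw [h]
        exact sub_mem (sub_mem (degreeLT_mono (by lia) hfs) (mul_mem_degreeLT hcomm hf hs))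
          (X_pow_mul_mem_degreeLT m hc)
      have hc0 : c = 0 := by simpa [hκ] using coeff_eq_zero_of_mem_degreeLT hκ hmem
      exact ih (by simpa [hc0] using hc)
  obtain ⟨n, hn⟩ := exists_mem_degreeLT hfree s
  exact key n hn

section Monic

variable {m : ℕ} {a : ℕ → B} {f : R}

theorem monic_sub_X_pow_mem_degreeLT (ham : a m = 1)
    (hf : f = ∑ i ∈ range (m + 1), X ^ i * ι (a i)) :
    f - X ^ m ∈ degreeLTSubgroup ι X m := by
  rw [hf, sum_range_succ, ham, map_one, mul_one, add_sub_cancel_right]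
  exact sum_mem fun i hi => monomial_mem_degreeLT (mem_range.1 hi) _

/-- A monic polynomial generating a two-sided ideal commutes with the coefficient ring. -/
theorem coe_mul_monic_comm
    (hcomm : ∀ α : B, ι α * X = X * ι α + ι (D α))
    (hfree : ∀ r : R, ∃! c : ℕ →₀ B, r = c.sum fun i b => X ^ i * ι b)
    (ham : a m = 1) (hf : f = ∑ i ∈ range (m + 1), X ^ i * ι (a i))
    (htwo : (Set.range fun r => f * r) = Set.range fun r => r * f) (α : B) :
    ι α * f = f * ι α := by
  have hlow := monic_sub_X_pow_mem_degreeLT ham hf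
  obtain ⟨s, hs : f * s = ι α * f⟩ : ι α * f ∈ Set.range fun r => f * r :=
    htwo ▸ ⟨ι α, rfl⟩
  have h : f * (s - ι α) =
      ι α * (f - X ^ m) - (f - X ^ m) * ι α + (ι α * X ^ m - X ^ m * ι α) := by
    rw [mul_sub, hs]
    noncomm_ring
  have h0 : s - ι α = 0 := by
    refine eq_zero_of_monic_mul_mem_degreeLT hcomm hfree hlow ?_
    rw [h]
    exact add_mem (sub_mem (coe_mul_mem_degreeLT hcomm hlow α) (mul_coe_mem_degreeLT hlow α))
      (coe_mul_X_pow_sub_mem_degreeLT hcomm m α)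
  rw [← hs, sub_eq_zero.1 h0]

/-- The coefficients of a monic polynomial generating a two-sided ideal are constants of the
derivation. -/
theorem derivation_coeff_monic_eq_zero
    (hD : ∀ α β : B, D (α * β) = D α * β + α * D β)
    (hcomm : ∀ α : B, ι α * X = X * ι α + ι (D α))
    (hfree : ∀ r : R, ∃! c : ℕ →₀ B, r = c.sum fun i b => X ^ i * ι b)
    (ham : a m = 1) (hf : f = ∑ i ∈ range (m + 1), X ^ i * ι (a i))
    (htwo : (Set.range fun r => f * r) = Set.range fun r => r * f) {i : ℕ} (hi : i ≤ m) :
    D (a i) = 0 := by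
  have hD1 : D 1 = 0 := by simpa using hD 1 1
  obtain ⟨s, hs : f * s = X * f⟩ : X * f ∈ Set.range fun r => f * r := htwo ▸ ⟨X, rfl⟩
  have h : f * (X - s) = ∑ i ∈ range m, X ^ i * ι (D (a i)) := by
    have hterm : ∀ i, X ^ i * ι (a i) * X - X * (X ^ i * ι (a i)) = X ^ i * ι (D (a i)) := by
      intro i
      rw [mul_assoc, hcomm, ← mul_assoc X, ← pow_succ', pow_succ]
      noncomm_ring
    rw [mul_sub, hs, hf, sum_mul, mul_sum, ← sum_sub_distrib, sum_congr rfl fun i _ => hterm i,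
      sum_range_succ, ham, hD1, map_zero, mul_zero, add_zero]
  have h0 : X - s = 0 := by
    refine eq_zero_of_monic_mul_mem_degreeLT hcomm hfree
      (monic_sub_X_pow_mem_degreeLT ham hf) ?_
    rw [h]
    exact sum_mem fun i hi => monomial_mem_degreeLT (mem_range.1 hi) _
  rw [h0, mul_zero] at h
  obtain ⟨κ, hκ⟩ := exists_coeff hfree
  rcases hi.lt_or_eq with hi | rfl
  · have := DFunLike.congr_fun (congrArg κ h) i
    simpa [hκ, Finsupp.finsetSum_apply, Finsupp.single_apply, hi] using this.symm
  · rw [ham, hD1]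

end Monic

end SkewPolynomial

section PowDerivation

variable {A : Type*} [Ring A]

/-- The value at `x ^ k` of the derivation sending `x` to `u`. -/
def powDerivation (x u : A) (k : ℕ) : A :=
  ∑ i ∈ range k, x ^ (k - 1 - i) * u * x ^ i

theorem powDerivation_zero (x u : A) : powDerivation x u 0 = 0 := by
  simp [powDerivation]

theorem powDerivation_succ (x u : A) (k : ℕ) :
    powDerivation x u (k + 1) = x * powDerivation x u k + u * x ^ k := by
  simp only [powDerivation, sum_range_succ, mul_sum, Nat.add_sub_cancel, Nat.sub_self, pow_zero,
    one_mul]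
  congr 1
  refine sum_congr rfl fun i hi => ?_
  have := mem_range.1 hi
  rw [show k - i = k - 1 - i + 1 by lia, pow_succ']
  simp only [mul_assoc]

theorem powDerivation_commutator (x w : A) (k : ℕ) :
    powDerivation x (w * x - x * w) k = w * x ^ k - x ^ k * w := by
  induction k with
  | zero => simp [powDerivation]
  | succ k ih =>
    rw [powDerivation_succ, ih, pow_succ']
    noncomm_ring

/-- The matrix encoding two successive derivations with values `u` and `v` at `x`. -/
def jetMatrix (x u v : A) : Matrix (Fin 3) (Fin 3) A :=
  !![x, u, 0; 0, x, v; 0, 0, x]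

theorem exists_jetMatrix_pow (x u v : A) (k : ℕ) :
    ∃ w, jetMatrix x u v ^ k =
      !![x ^ k, powDerivation x u k, w; 0, x ^ k, powDerivation x v k; 0, 0, x ^ k] := by
  induction k with
  | zero =>
    refine ⟨0, ?_⟩
    ext i j
    fin_cases i <;> fin_cases j <;> simp [powDerivation_zero]
  | succ k ih =>
    obtain ⟨w, hw⟩ := ih
    refine ⟨x * w + u * powDerivation x v k, ?_⟩
    rw [pow_succ', hw, jetMatrix]
    ext i j
    fin_cases i <;> fin_cases j <;>
      simp [Matrix.mul_apply, Fin.sum_univ_three, powDerivation_succ, pow_succ']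

theorem exists_sum_jetMatrix_pow (x u v : A) (c : ℕ → A) (n : ℕ) :
    ∃ w, ∑ k ∈ range n, jetMatrix x u v ^ k * Matrix.scalar (Fin 3) (c k) =
      !![∑ k ∈ range n, x ^ k * c k, ∑ k ∈ range n, powDerivation x u k * c k, w;
        0, ∑ k ∈ range n, x ^ k * c k, ∑ k ∈ range n, powDerivation x v k * c k;
        0, 0, ∑ k ∈ range n, x ^ k * c k] := by
  choose w hw using exists_jetMatrix_pow x u v
  refine ⟨∑ k ∈ range n, w k * c k, ?_⟩
  simp only [hw]
  ext i j
  rw [Matrix.sum_apply]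
  fin_cases i <;> fin_cases j <;>
    simp [Matrix.scalar_apply, Matrix.mul_diagonal]

end PowDerivation

theorem sum_mul_mul_pow_eq_sum_powDerivation {A : Type*} [Ring A] {x u : A} {c y : ℕ → A} {m : ℕ}
    (hm : 1 ≤ m)
    (hy : ∀ j, y j = ∑ k ∈ Icc j (m - 1), x ^ (k - j) * c (k + 1))
    (hcx : ∀ k ≤ m, c k * x = x * c k) (hcu : ∀ k, c k * u = u * c k) :
    ∑ j ∈ range m, y j * u * x ^ j = ∑ k ∈ range (m + 1), powDerivation x u k * c k := by
  rw [sum_range_succ', powDerivation_zero, zero_mul, add_zero]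
  simp only [hy, powDerivation, sum_mul]
  rw [sum_comm' (t' := range m) (s' := fun k => range (k + 1))]
  · refine sum_congr rfl fun k hk => sum_congr rfl fun j _ => ?_
    have hc : Commute (c (k + 1)) (x ^ j) :=
      Commute.pow_right (hcx _ (mem_range.1 hk)) j
    rw [Nat.add_sub_cancel, mul_assoc (x ^ (k - j)) (c (k + 1)) u, hcu, mul_assoc, mul_assoc,
      mul_assoc, hc.eq, mul_assoc]
  · intro j k
    simp only [mem_range, mem_Icc]
    lia

/-- In the derivation-type case `R = B[X;D]` (`ρ = id`), a monic
`f = Σ_{i=0}^{m} X^i a_i` of degree `m ≥ 1` with `fR = Rf` is separable in `R`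
(equivalently, by Miyashita's criterion, there exists `u ∈ V` with `τ(u) = 1`) if and
only if the sequence `V → V → C(A) → 0`, with maps `I_x` and `τ`, is exact; that is,
if and only if `{v ∈ V : τ(v) = 0} = I_x(V)` and `τ(V) = C(A)`. -/
theorem stmt16 {B R A : Type*} [Ring B] [Ring R] [Ring A]
    (ι : B →+* R) (hι : Function.Injective ι) (X : R)
    (D : B →+ B)
    (hD : ∀ α β : B, D (α * β) = D α * β + α * D β)
    (hcomm : ∀ α : B, ι α * X = X * ι α + ι (D α))
    (hfree : ∀ r : R, ∃! c : ℕ →₀ B, r = c.sum fun i b => X ^ i * ι b)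
    (m : ℕ) (hm : 1 ≤ m) (a : ℕ → B) (ham : a m = 1)
    (f : R) (hf : f = ∑ i ∈ Finset.range (m + 1), X ^ i * ι (a i))
    (htwo : (Set.range fun r => f * r) = Set.range fun r => r * f)
    (π : R →+* A) (hπ : Function.Surjective π)
    (hker : ∀ r : R, π r = 0 ↔ ∃ s, r = f * s)
    (y : ℕ → A)
    (hy : ∀ j, y j = ∑ k ∈ Finset.Icc j (m - 1), π X ^ (k - j) * π (ι (a (k + 1))))
    (τ : A → A)
    (hτ : ∀ z, τ z = ∑ j ∈ Finset.range m, y j * z * π X ^ j) :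
    (∃ u : A, (∀ α : B, π (ι α) * u = u * π (ι α)) ∧ τ u = 1) ↔
      ({v : A | (∀ α : B, π (ι α) * v = v * π (ι α)) ∧ τ v = 0} =
          (fun v => v * π X - π X * v) ''
            {v : A | ∀ α : B, π (ι α) * v = v * π (ι α)} ∧
        τ '' {v : A | ∀ α : B, π (ι α) * v = v * π (ι α)} =
          {z : A | ∀ w : A, z * w = w * z}) := by
  obtain ⟨x, hx⟩ : ∃ x, π X = x := ⟨_, rfl⟩
  simp only [hx] at hy hτ ⊢
  let c : ℕ → A := fun k => π (ι (a k))
  have hBx : ∀ α, π (ι α) * x = x * π (ι α) + π (ι (D α)) := fun α => by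
    rw [← hx, ← map_mul, hcomm, map_add, map_mul]
  have hcx : ∀ k ≤ m, c k * x = x * c k := fun k hk => by
    simp [c, hBx, derivation_coeff_monic_eq_zero hD hcomm hfree ham hf htwo hk]
  have hfx : ∑ k ∈ range (m + 1), x ^ k * c k = 0 := by
    have := (hker f).2 ⟨1, (mul_one f).symm⟩
    rw [hf, map_sum] at this
    simpa [hx, c] using this
  have hτV : ∀ u, (∀ α, π (ι α) * u = u * π (ι α)) →
      τ u = ∑ k ∈ range (m + 1), powDerivation x u k * c k := fun u hu => by
    rw [hτ]
    exact sum_mul_mul_pow_eq_sum_powDerivation hm hy hcx fun k => hu _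
  -- The image of `f` under the representation of `R` by jet matrices.
  have hrep : ∀ u v, (∀ α, π (ι α) * u = u * π (ι α)) → (∀ α, π (ι α) * v = v * π (ι α)) →
      ∃ w, (∀ α, π (ι α) * w = w * π (ι α)) ∧ (∀ α, π (ι α) * τ u = τ u * π (ι α)) ∧
        x * τ u = τ u * x ∧ x * w + u * τ v = τ u * v + w * x := by
    intro u v hu hv
    obtain ⟨Φ, hΦB, hΦX⟩ := exists_skewPolynomial_lift hcomm hfree
      ((Matrix.scalar (Fin 3)).comp (π.comp ι)) (jetMatrix x u v) fun α => by
        ext i j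
        fin_cases i <;> fin_cases j <;>
          simp [jetMatrix, Matrix.scalar_apply, Matrix.diagonal_mul, hBx, hu, hv]
    obtain ⟨w, hw⟩ := exists_sum_jetMatrix_pow x u v c (m + 1)
    have hΦf : Φ f = !![0, τ u, w; 0, 0, τ v; 0, 0, 0] := by
      rw [hfx, ← hτV u hu, ← hτV v hv] at hw
      rw [← hw, hf, map_sum]
      simp [hΦB, hΦX, c]
    have hB : ∀ α, Matrix.scalar (Fin 3) (π (ι α)) * Φ f =
        Φ f * Matrix.scalar (Fin 3) (π (ι α)) := fun α => by
      have := congrArg Φ (coe_mul_monic_comm hcomm hfree ham hf htwo α)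
      simpa [hΦB] using this
    have hXf : X * f = f * X := by
      rw [hf, mul_sum, sum_mul]
      refine sum_congr rfl fun i hi => ?_
      rw [mul_assoc, hcomm, derivation_coeff_monic_eq_zero hD hcomm hfree ham hf htwo
        (Nat.lt_succ_iff.1 (mem_range.1 hi)), map_zero, add_zero, ← mul_assoc, ← mul_assoc,
        ← pow_succ, ← pow_succ']
    have hM : jetMatrix x u v * Φ f = Φ f * jetMatrix x u v := by
      rw [← hΦX, ← map_mul, hXf, map_mul]
    rw [hΦf] at hB hM
    refine ⟨w, fun α => ?_, fun α => ?_, ?_, ?_⟩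
    · simpa [Matrix.scalar_apply, Matrix.mul_diagonal, Matrix.diagonal_mul] using
        congrFun (congrFun (hB α) 0) 2
    · simpa [Matrix.scalar_apply, Matrix.mul_diagonal, Matrix.diagonal_mul] using
        congrFun (congrFun (hB α) 0) 1
    · simpa [jetMatrix, Matrix.mul_apply, Fin.sum_univ_three] using congrFun (congrFun hM 0) 1
    · simpa [jetMatrix, Matrix.mul_apply, Fin.sum_univ_three] using congrFun (congrFun hM 0) 2
  constructor
  · rintro ⟨u, hu, hu1⟩
    refine ⟨Set.Subset.antisymm ?_ ?_, Set.Subset.antisymm ?_ ?_⟩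
    · rintro v ⟨hv, hv0⟩
      obtain ⟨w, hwB, -, -, hw⟩ := hrep u v hu hv
      refine ⟨-w, fun α => by simp [hwB], ?_⟩
      rw [hv0, hu1, mul_zero, add_zero, one_mul] at hw
      simp [hw]
    · rintro _ ⟨w, hw, rfl⟩
      have hw : ∀ α, π (ι α) * w = w * π (ι α) := hw
      have hV : ∀ α, π (ι α) * (w * x - x * w) = (w * x - x * w) * π (ι α) := fun α => by
        rw [mul_sub, ← mul_assoc, ← mul_assoc, hw, hBx, mul_assoc w, hBx, add_mul, mul_assoc x,
          hw, hw, mul_add, sub_mul]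
        simp only [mul_assoc]
        abel
      refine ⟨hV, ?_⟩
      have h : ∀ k, powDerivation x (w * x - x * w) k * c k =
          w * (x ^ k * c k) - x ^ k * c k * w := fun k => by
        rw [powDerivation_commutator, sub_mul, mul_assoc, mul_assoc, mul_assoc, hw]
      rw [hτV _ hV, sum_congr rfl fun k _ => h k, sum_sub_distrib, ← mul_sum, ← sum_mul, hfx,
        mul_zero, zero_mul, sub_zero]
    · rintro _ ⟨v, hv, rfl⟩ z
      obtain ⟨-, -, hB, hX, -⟩ := hrep v v hv hv
      obtain ⟨r, rfl⟩ := hπ z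
      obtain ⟨d, rfl, -⟩ := hfree r
      have hmem : ∀ i b, Commute (τ v) (π (X ^ i * ι b)) := fun i b => by
        rw [map_mul, map_pow, hx]
        exact (Commute.pow_right hX.symm i).mul_right (hB b).symm
      rw [Finsupp.sum, map_sum]
      exact Commute.sum_right _ _ _ fun i _ => hmem i _
    · intro z hz
      have hz : ∀ w, z * w = w * z := hz
      refine ⟨u * z, fun α => by rw [← mul_assoc, hu, mul_assoc, mul_assoc, hz], ?_⟩
      have h : ∀ j, y j * (u * z) * x ^ j = y j * u * x ^ j * z := fun j => by
        simp only [mul_assoc, hz]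
      rw [hτ, sum_congr rfl fun j _ => h j, ← sum_mul, ← hτ, hu1, one_mul]
  · rintro ⟨-, h⟩
    have h1 : (1 : A) ∈ {z : A | ∀ w : A, z * w = w * z} := by simp
    rw [← h] at h1
    exact h1
end

section
/- Let B be the ring of 2×2 upper triangular matrices over ℤ, D the derivation of B sending [[b₁,b₂],[0,b₃]] to [[0,b₂],[0,0]], a = [[3,0],[0,1]] ∈ B, and f = X² + Xa + a in R = B[X;D]. Then fR = Rf, and f is weakly separable in R: every B-derivation of A = R/fR is inner. -/
/-- The ring of 2×2 upper triangular matrices over `ℤ`, as a subring of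
`Matrix (Fin 2) (Fin 2) ℤ`. -/
def UT : Subring (Matrix (Fin 2) (Fin 2) ℤ) where
  carrier := {M | M 1 0 = 0}
  mul_mem' := by
    intro M N hM hN
    simp only [Set.mem_setOf_eq] at *
    simp [Matrix.mul_apply, Fin.sum_univ_two, hM, hN]
  one_mem' := by simp [Matrix.one_apply]
  add_mem' := by
    intro M N hM hN
    simp only [Set.mem_setOf_eq] at *
    simp [hM, hN]
  zero_mem' := by simp
  neg_mem' := by
    intro M hM
    simp only [Set.mem_setOf_eq] at *
    simp [hM]

/-- The derivation `D` of `UT` sending `[[b₁,b₂],[0,b₃]]` to `[[0,b₂],[0,0]]`. -/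
def Dut (M : UT) : UT :=
  ⟨!![0, (M : Matrix (Fin 2) (Fin 2) ℤ) 0 1; 0, 0], by
    show (!![0, (M : Matrix (Fin 2) (Fin 2) ℤ) 0 1; 0, 0]) 1 0 = 0
    simp⟩

/-- The matrix `a = [[3,0],[0,1]]` as an element of `UT`. -/
def aUT : UT := ⟨!![3, 0; 0, 1], by show (!![(3 : ℤ), 0; 0, 1]) 1 0 = 0; simp⟩

open Polynomial in
/-- Evaluation of a polynomial with central variable at `X`, with coefficients written on the
right. -/
noncomputable def rightEval {B R : Type*} [Ring B] [Ring R] (ι : B →+* R) (X : R) : B[X] →+ R where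
  toFun p := p.sum fun i b => X ^ i * ι b
  map_zero' := by simp
  map_add' p q := Polynomial.sum_add_index p q _ (by simp) (by simp [mul_add])

namespace rightEval

open Polynomial

variable {B R : Type*} [Ring B] [Ring R] (ι : B →+* R) (X : R)

lemma apply_monomial (i : ℕ) (b : B) : rightEval ι X (monomial i b) = X ^ i * ι b :=
  Polynomial.sum_monomial_index b (fun i b => X ^ i * ι b) (by simp)

lemma apply_linear (c d : B) :
    rightEval ι X (monomial 1 c + monomial 0 d) = X * ι c + ι d := by
  simp only [map_add, apply_monomial, pow_one, pow_zero, one_mul]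

variable {ι X}

lemma injective
    (hfree : ∀ r : R, ∃! c : ℕ →₀ B, r = c.sum fun i b => X ^ i * ι b) :
    Function.Injective (rightEval ι X) := by
  intro p q h
  let c : B[X] → (ℕ →₀ B) := fun p => ⟨p.support, p.coeff, fun _ => mem_support_iff⟩
  have key : c p = c q :=
    (hfree (rightEval ι X p)).unique (y₁ := c p) (y₂ := c q) rfl (h.trans rfl)
  ext1 n
  exact DFunLike.congr_fun key n

lemma surjective
    (hfree : ∀ r : R, ∃! c : ℕ →₀ B, r = c.sum fun i b => X ^ i * ι b) :
    Function.Surjective (rightEval ι X) := by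
  intro r
  obtain ⟨c, hc, -⟩ := hfree r
  refine ⟨∑ i ∈ c.support, monomial i (c i), ?_⟩
  rw [map_sum, hc]
  exact Finset.sum_congr rfl fun i _ => apply_monomial ι X i (c i)

/-- Multiplication by a quadratic that commutes with `X` is computed coefficientwise. -/
lemma apply_quadratic_mul (a b : B) {f : R} (hf : f = X ^ 2 + X * ι a + ι b)
    (hX : Commute f X) (s : B[X]) :
    rightEval ι X ((Polynomial.X ^ 2 + Polynomial.X * C a + C b) * s)
      = f * rightEval ι X s := by
  induction s using Polynomial.induction_on' with
  | add p q hp hq => rw [mul_add, map_add, hp, hq, map_add, mul_add]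
  | monomial n c =>
    have h : (Polynomial.X ^ 2 + Polynomial.X * C a + C b) * monomial n c
        = monomial (n + 2) c + monomial (n + 1) (a * c) + monomial n (b * c) := by
      rw [add_mul, add_mul, mul_assoc Polynomial.X, C_mul_monomial, C_mul_monomial,
        X_mul_monomial, X_pow_mul_monomial]
    rw [h, map_add, map_add, apply_monomial, apply_monomial, apply_monomial, apply_monomial,
      ← mul_assoc, (hX.pow_right n).eq, hf, mul_assoc]
    simp only [map_mul, add_mul, mul_add, pow_add, pow_one, mul_assoc]

lemma quadratic_eq (a b : B) : (Polynomial.X ^ 2 + Polynomial.X * C a + C b : B[X])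
    = Polynomial.X ^ 2 + (C a * Polynomial.X + C b) := by
  rw [X_mul_C, add_assoc]

lemma monic_quadratic (a b : B) :
    (Polynomial.X ^ 2 + Polynomial.X * C a + C b : B[X]).Monic := by
  rw [quadratic_eq]
  exact monic_X_pow_add (degree_linear_le.trans_lt (by norm_num))

lemma degree_quadratic [Nontrivial B] (a b : B) :
    (Polynomial.X ^ 2 + Polynomial.X * C a + C b : B[X]).degree = 2 := by
  rw [quadratic_eq]
  rw [degree_add_eq_left_of_degree_lt, degree_X_pow, Nat.cast_ofNat]
  rw [degree_X_pow]
  exact degree_linear_le.trans_lt (by norm_num)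

/-- Every element is congruent to a linear one modulo a quadratic commuting with `X`. -/
lemma exists_eq_linear_add_mul [Nontrivial B]
    (hfree : ∀ r : R, ∃! c : ℕ →₀ B, r = c.sum fun i b => X ^ i * ι b)
    (a b : B) {f : R}
    (hf : f = X ^ 2 + X * ι a + ι b) (hX : Commute f X) (r : R) :
    ∃ c d s, r = X * ι c + ι d + f * s := by
  obtain ⟨p, rfl⟩ := surjective hfree r
  set g : B[X] := Polynomial.X ^ 2 + Polynomial.X * C a + C b
  have hdeg : (p %ₘ g).degree ≤ 1 := by
    have h := degree_modByMonic_lt p (monic_quadratic a b)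
    rw [degree_quadratic] at h
    exact Order.le_of_lt_succ (a := (p %ₘ g).degree) (b := 1) h
  refine ⟨(p %ₘ g).coeff 1, (p %ₘ g).coeff 0, rightEval ι X (p /ₘ g), ?_⟩
  conv_lhs => rw [← modByMonic_add_div p g]
  rw [map_add, apply_quadratic_mul a b hf hX, ← apply_linear, monomial_zero_left,
    ← C_mul_X_eq_monomial, ← eq_X_add_C_of_degree_le_one hdeg]

/-- A nonzero linear element is not a multiple of a quadratic commuting with `X`. -/
lemma linear_eq_mul [Nontrivial B]
    (hfree : ∀ r : R, ∃! c : ℕ →₀ B, r = c.sum fun i b => X ^ i * ι b)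
    (a b : B) {f : R}
    (hf : f = X ^ 2 + X * ι a + ι b) (hX : Commute f X) {c d : B} {s : R}
    (h : X * ι c + ι d = f * s) : c = 0 ∧ d = 0 := by
  obtain ⟨q, rfl⟩ := surjective hfree s
  rw [← apply_quadratic_mul a b hf hX, ← apply_linear] at h
  have h := injective hfree h
  have hq : q = 0 := by
    by_contra hq
    have hndvd := (monic_quadratic a b).not_dvd_of_degree_lt
      (p := Polynomial.X ^ 2 + Polynomial.X * C a + C b) (q := monomial 1 c + monomial 0 d)
      (by rw [h]; exact fun h0 => hq (((monic_quadratic a b).mul_right_eq_zero_iff).1 h0))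
      (by
        rw [degree_quadratic, monomial_zero_left, ← C_mul_X_eq_monomial]
        exact degree_linear_le.trans_lt (by norm_num))
    exact hndvd ⟨q, h⟩
  rw [hq, mul_zero] at h
  have h1 := congrArg (fun p => coeff p 1) h
  have h0 := congrArg (fun p => coeff p 0) h
  simp only [coeff_add, coeff_monomial, coeff_zero] at h1 h0
  exact ⟨by simpa using h1, by simpa using h0⟩

end rightEval

/-- The coefficients of `δ x`, for a `UT`-derivation `δ`, satisfy a linear system with only the
trivial solution. -/
lemma UT.eq_zero_of_relations {c d : UT} (hc : ∀ α, α * c = c * α)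
    (hd : ∀ α, Dut α * c + α * d = d * α)
    (h1 : Dut c + 2 * d + c * aUT - 2 * (aUT * c) = 0)
    (h0 : Dut d + d * aUT - 2 * (aUT * c) = 0) : c = 0 ∧ d = 0 := by
  let e11 : UT := ⟨!![1, 0; 0, 0], show (!![(1 : ℤ), 0; 0, 0]) 1 0 = 0 by simp⟩
  let e12 : UT := ⟨!![0, 1; 0, 0], show (!![(0 : ℤ), 1; 0, 0]) 1 0 = 0 by simp⟩
  have hc11 := congrArg Subtype.val (hc e11)
  have hc12 := congrArg Subtype.val (hc e12)
  have hd11 := congrArg Subtype.val (hd e11)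
  have hd12 := congrArg Subtype.val (hd e12)
  rw [two_mul, two_mul] at h1
  rw [two_mul] at h0
  have h1 := congrArg Subtype.val h1
  have h0 := congrArg Subtype.val h0
  obtain ⟨c, hc0 : c 1 0 = 0⟩ := c
  obtain ⟨d, hd0 : d 1 0 = 0⟩ := d
  simp [e11, e12, Dut, aUT, ← Matrix.ext_iff, Fin.forall_fin_two, Matrix.mul_apply,
    Matrix.vecMul, dotProduct, Fin.sum_univ_two, hc0, hd0] at hc11 hc12 hd11 hd12 h1 h0
  constructor <;> apply Subtype.ext <;>
    simp only [← Matrix.ext_iff, Fin.forall_fin_two, ZeroMemClass.coe_zero, Matrix.zero_apply] <;>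
    refine ⟨⟨?_, ?_⟩, ?_, ?_⟩ <;> omega

lemma Dut_aUT : Dut aUT = 0 := by
  apply Subtype.ext
  simp [Dut, aUT, ← Matrix.ext_iff, Fin.forall_fin_two]

lemma Dut_Dut (α : UT) : Dut (Dut α) = Dut α := by
  apply Subtype.ext
  simp [Dut]

lemma Dut_mul_aUT (α : UT) : Dut α * aUT = Dut α := by
  apply Subtype.ext
  ext i j
  fin_cases i <;> fin_cases j <;> simp [Dut, aUT]

lemma aUT_mul (α : UT) : aUT * α = α * aUT + Dut α + Dut α := by
  obtain ⟨α, hα : α 1 0 = 0⟩ := α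
  apply Subtype.ext
  simp [Dut, aUT, ← Matrix.ext_iff, Fin.forall_fin_two, Matrix.mul_apply, Matrix.vecMul,
    dotProduct, Fin.sum_univ_two, hα]
  omega

lemma UT.commute_quadratic_X {R : Type*} [Ring R] {ι : UT →+* R} {X : R}
    (hcomm : ∀ α : UT, ι α * X = X * ι α + ι (Dut α)) :
    Commute (X ^ 2 + X * ι aUT + ι aUT) X := by
  have h : Commute (ι aUT) X := by
    rw [Commute, SemiconjBy, hcomm, Dut_aUT, map_zero, add_zero]
  have hX : Commute X X := Commute.refl X
  exact ((hX.pow_left 2).add_left (hX.mul_left h)).add_left h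

lemma UT.commute_quadratic_coeff {R : Type*} [Ring R] {ι : UT →+* R} {X : R}
    (hcomm : ∀ α : UT, ι α * X = X * ι α + ι (Dut α)) (α : UT) :
    Commute (X ^ 2 + X * ι aUT + ι aUT) (ι α) := by
  have h2 : ι α * X ^ 2 = X ^ 2 * ι α + X * ι (Dut α) + X * ι (Dut α) + ι (Dut α) := by
    rw [pow_two, ← mul_assoc, hcomm, add_mul, mul_assoc, hcomm, hcomm, Dut_Dut]
    noncomm_ring
  have h1 : ι α * (X * ι aUT) = X * ι (α * aUT) + ι (Dut α) := by
    rw [← mul_assoc, hcomm, add_mul, ← map_mul, Dut_mul_aUT, mul_assoc, ← map_mul]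
  rw [Commute, SemiconjBy, mul_add, mul_add, h2, h1, add_mul, add_mul, mul_assoc X, ← map_mul,
    ← map_mul, aUT_mul]
  simp only [map_add]
  noncomm_ring

/-- Let `B = UT` be the ring of 2×2 upper triangular integer matrices, `D` the derivation
sending `[[b₁,b₂],[0,b₃]]` to `[[0,b₂],[0,0]]`, `a = [[3,0],[0,1]]`, and
`f = X² + Xa + a` in `R = B[X;D]`.  Then `fR = Rf`, and `f` is weakly separable in `R`:
every `B`-derivation of `A = R/fR` is inner. -/
theorem stmt17 {R A : Type*} [Ring R] [Ring A]
    (ι : UT →+* R) (hι : Function.Injective ι) (X : R)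
    (hcomm : ∀ α : UT, ι α * X = X * ι α + ι (Dut α))
    (hfree : ∀ r : R, ∃! c : ℕ →₀ UT, r = c.sum fun i b => X ^ i * ι b)
    (f : R) (hf : f = X ^ 2 + X * ι aUT + ι aUT)
    (π : R →+* A) (hπ : Function.Surjective π)
    (hker : ∀ r : R, π r = 0 ↔ ∃ s, r = f * s) :
    ((Set.range fun r => f * r) = Set.range fun r => r * f) ∧
      ∀ δ : A → A, (∀ z w : A, δ (z + w) = δ z + δ w) →
        (∀ z w : A, δ (z * w) = δ z * w + z * δ w) →
        (∀ β : UT, δ (π (ι β)) = 0) →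
        ∃ v : A, ∀ z : A, δ z = v * z - z * v := by
  have hX : Commute f X := hf ▸ UT.commute_quadratic_X hcomm
  have hcoeff : ∀ α, Commute f (ι α) := hf ▸ UT.commute_quadratic_coeff hcomm
  have hcentral : ∀ r, f * r = r * f := by
    intro r
    obtain ⟨c, rfl, -⟩ := hfree r
    exact (Commute.sum_right _ _ _ fun i _ => (hX.pow_right i).mul_right (hcoeff (c i))).eq
  refine ⟨congrArg Set.range (funext hcentral), fun δ hadd hmul hB => ⟨0, ?_⟩⟩
  have hπf : π f = 0 := (hker f).2 ⟨1, (mul_one f).symm⟩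
  have hfree' : ∀ {c d : UT}, π (X * ι c + ι d) = 0 → c = 0 ∧ d = 0 := by
    intro c d h
    obtain ⟨s, hs⟩ := (hker _).1 h
    exact rightEval.linear_eq_mul hfree aUT aUT hf hX hs
  obtain ⟨r, hr⟩ := hπ (δ (π X))
  obtain ⟨c, d, s, hs⟩ := rightEval.exists_eq_linear_add_mul hfree aUT aUT hf hX r
  have hy : δ (π X) = π (X * ι c + ι d) := by
    rw [← hr, hs, map_add, map_mul π f, hπf, zero_mul, add_zero]
  have hδ : ∀ α, ι α * (X * ι c + ι d) - (X * ι c + ι d) * ι α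
      = X * ι (α * c - c * α) + ι (Dut α * c + α * d - d * α) := by
    intro α
    rw [mul_add, ← mul_assoc, hcomm]
    simp only [map_add, map_sub, map_mul]
    noncomm_ring
  have hcommδ : ∀ α, π (ι α) * δ (π X) = δ (π X) * π (ι α) := by
    intro α
    have h := congrArg δ (congrArg π (hcomm α))
    simpa only [map_add, map_mul, hadd, hmul, hB, zero_mul, mul_zero, add_zero, zero_add] using h
  have hrel : ∀ α, α * c - c * α = 0 ∧ Dut α * c + α * d - d * α = 0 := by
    intro α
    apply hfree'
    rw [← hδ, map_sub, map_mul, map_mul, ← hy, hcommδ, sub_self]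
  have hδ0 : δ 0 = 0 := by simpa using hB 0
  have hquad : δ (π X) * π X + π X * δ (π X) + δ (π X) * π (ι aUT) = 0 := by
    have h : δ (π f) = 0 := by rw [hπf, hδ0]
    simpa only [hf, pow_two, map_add, map_mul, hadd, hmul, hB, zero_mul, mul_zero, add_zero,
      zero_add] using h
  have hcd : c = 0 ∧ d = 0 := by
    have h : (X * ι c + ι d) * X + X * (X * ι c + ι d) + (X * ι c + ι d) * ι aUT
        = f * ι (2 * c) + (X * ι (Dut c + 2 * d + c * aUT - 2 * (aUT * c))
          + ι (Dut d + d * aUT - 2 * (aUT * c))) := by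
      rw [add_mul, mul_assoc, hcomm, hcomm, hf]
      simp only [map_add, map_sub, map_mul, map_ofNat]
      noncomm_ring
    have hlin := congrArg π h
    rw [map_add π (f * _), map_mul π f, hπf, zero_mul, zero_add, map_add π, map_add π, map_mul π,
      map_mul π X (X * ι c + ι d), map_mul π _ (ι aUT), ← hy, hquad] at hlin
    obtain ⟨h1, h0⟩ := hfree' hlin.symm
    exact UT.eq_zero_of_relations (fun α => sub_eq_zero.1 (hrel α).1)
      (fun α => sub_eq_zero.1 (hrel α).2) h1 h0
  have hx : δ (π X) = 0 := by rw [hy, hcd.1, hcd.2]; simp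
  have hpow : ∀ n : ℕ, δ (π X ^ n) = 0 := by
    intro n
    induction n with
    | zero => simpa using hB 1
    | succ n ih => rw [pow_succ, hmul, ih, hx, zero_mul, mul_zero, add_zero]
  intro z
  obtain ⟨r, rfl⟩ := hπ z
  obtain ⟨c, rfl, -⟩ := hfree r
  let δ' : A →+ A := ⟨⟨δ, hδ0⟩, hadd⟩
  have h : δ' (π (c.sum fun i b => X ^ i * ι b)) = 0 := by
    rw [Finsupp.sum, map_sum, map_sum]
    refine Finset.sum_eq_zero fun i _ => ?_
    change δ (π (X ^ i * ι (c i))) = 0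
    rw [map_mul, map_pow, hmul, hpow, hB, zero_mul, mul_zero, add_zero]
  rw [zero_mul, mul_zero, sub_zero]
  exact h
end

section
/- Let B be the ring of 2×2 upper triangular matrices over ℤ, D the derivation of B sending [[b₁,b₂],[0,b₃]] to [[0,b₂],[0,0]], a = [[3,0],[0,1]] ∈ B, and f = X² + Xa + a in R = B[X;D]. Then f is not separable in R: there is no element u of the centralizer V of B in A = R/fR with τ(u) = 1, where τ(z) = (x + a)z + zx; equivalently, τ(V) is a proper subset of the center C(A) of A. -/
/-- Left multiplication by `x` on `A = xB ⊕ B` in coordinates, where `x² = -xa - a`. -/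
def quadShift {B : Type*} [Ring B] (a : B) : AddMonoid.End (B × B) where
  toFun p := (p.2 - a * p.1, -(a * p.1))
  map_zero' := by simp
  map_add' p q := by
    ext
    · simp only [Prod.fst_add, Prod.snd_add, mul_add]; abel
    · simp only [Prod.fst_add, Prod.snd_add, mul_add]; abel

theorem quadShift_apply {B : Type*} [Ring B] (a : B) (p : B × B) :
    quadShift a p = (p.2 - a * p.1, -(a * p.1)) := rfl

/-- The coordinates in `xB ⊕ B` of the class of `∑ Xⁱ cᵢ` modulo `X² + Xa + a`. -/
noncomputable def quadCoords {B : Type*} [Ring B] (a : B) : (ℕ →₀ B) →+ B × B :=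
  Finsupp.liftAddHom fun i => ((quadShift a) ^ i : AddMonoid.End (B × B)).comp
    (AddMonoidHom.inr B B)

theorem quadCoords_single {B : Type*} [Ring B] (a : B) (i : ℕ) (b : B) :
    quadCoords a (Finsupp.single i b) = (quadShift a ^ i) (0, b) := by
  simp only [quadCoords, Finsupp.liftAddHom_apply_single]
  rfl

theorem quadCoords_single_quadratic {B : Type*} [Ring B] (a : B) (i : ℕ) (b : B) :
    quadCoords a (Finsupp.single (i + 2) b + Finsupp.single (i + 1) (a * b) +
      Finsupp.single i (a * b)) = 0 := by
  simp only [map_add, quadCoords_single]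
  rw [pow_add, pow_add, AddMonoid.End.coe_mul, AddMonoid.End.coe_mul,
    Function.comp_apply, Function.comp_apply, ← map_add, ← map_add]
  convert map_zero (quadShift a ^ i) using 2
  rw [pow_two, pow_one, AddMonoid.End.coe_mul, Function.comp_apply]
  simp [quadShift_apply]

/-- The additive map `c ↦ ∑ Xⁱ cᵢ`. -/
noncomputable def skewSum {B R : Type*} [Ring B] [Ring R] (ι : B →+* R) (X : R) :
    (ℕ →₀ B) →+ R :=
  Finsupp.liftAddHom fun i => (AddMonoidHom.mulLeft (X ^ i)).comp ι.toAddMonoidHom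

theorem skewSum_apply {B R : Type*} [Ring B] [Ring R] (ι : B →+* R) (X : R) (c : ℕ →₀ B) :
    skewSum ι X c = c.sum fun i b => X ^ i * ι b := by
  rfl

theorem skewSum_single {B R : Type*} [Ring B] [Ring R] (ι : B →+* R) (X : R) (i : ℕ) (b : B) :
    skewSum ι X (Finsupp.single i b) = X ^ i * ι b := by
  simp [skewSum]

theorem exists_quadratic_mul_skewSum {B R : Type*} [Ring B] [Ring R] (ι : B →+* R) (X : R)
    (a : B) (ha : Commute X (ι a)) (c : ℕ →₀ B) :
    ∃ d, (X ^ 2 + X * ι a + ι a) * skewSum ι X c = skewSum ι X d ∧ quadCoords a d = 0 := by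
  induction c using Finsupp.induction_linear with
  | zero => exact ⟨0, by simp, by simp⟩
  | add c c' hc hc' =>
    obtain ⟨d, hd, hd0⟩ := hc
    obtain ⟨d', hd', hd0'⟩ := hc'
    exact ⟨d + d', by rw [map_add, map_add, mul_add, hd, hd'], by rw [map_add, hd0, hd0', add_zero]⟩
  | single i b =>
    refine ⟨_, ?_, quadCoords_single_quadratic a i b⟩
    have hf : Commute (X ^ 2 + X * ι a + ι a) (X ^ i) :=
      (((((Commute.refl X).pow_left 2).add_left ((Commute.refl X).mul_left ha.symm)).add_left
        ha.symm).pow_right i)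
    simp only [map_add, skewSum_single, map_mul]
    rw [← mul_assoc, hf.eq]
    simp only [pow_succ, pow_zero, one_mul, mul_add, add_mul, mul_assoc]

/-- If the powers of `X` form a right basis, no nonzero linear polynomial is a multiple of
`X² + Xa + a`. -/
theorem eq_zero_of_linear_eq_quadratic_mul {B R : Type*} [Ring B] [Ring R] (ι : B →+* R) (X : R)
    (hfree : ∀ r : R, ∃! c : ℕ →₀ B, r = c.sum fun i b => X ^ i * ι b)
    (a : B) (ha : Commute X (ι a)) {b₁ b₀ : B} {s : R}
    (h : X * ι b₁ + ι b₀ = (X ^ 2 + X * ι a + ι a) * s) : b₁ = 0 ∧ b₀ = 0 := by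
  obtain ⟨c, hc, -⟩ := hfree s
  obtain ⟨d, hd, hd0⟩ := exists_quadratic_mul_skewSum ι X a ha c
  rw [skewSum_apply, ← hc, ← h] at hd
  have hlin : X * ι b₁ + ι b₀ =
      skewSum ι X (Finsupp.single 1 b₁ + Finsupp.single 0 b₀) := by
    simp [skewSum_single]
  have heq : Finsupp.single 1 b₁ + Finsupp.single 0 b₀ = d :=
    (hfree (X * ι b₁ + ι b₀)).unique (by rw [hlin, skewSum_apply]) (by rw [hd, skewSum_apply])
  rw [← heq, map_add, quadCoords_single, quadCoords_single, pow_one, pow_zero,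
    AddMonoid.End.coe_one, id, quadShift_apply] at hd0
  simpa using hd0

/-- Every element of a quotient in which `x² = -xa - a` is linear in `x`. -/
theorem exists_linear_of_skewSum {B A : Type*} [Ring B] [Ring A] (j : B →+* A) (x : A)
    (a : B) (hx : x * x = -(x * j a) - j a) (c : ℕ →₀ B) :
    ∃ b₁ b₀ : B, skewSum j x c = x * j b₁ + j b₀ := by
  induction c using Finsupp.induction_linear with
  | zero => exact ⟨0, 0, by simp⟩
  | add c c' hc hc' =>
    obtain ⟨b₁, b₀, h⟩ := hc
    obtain ⟨b₁', b₀', h'⟩ := hc'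
    refine ⟨b₁ + b₁', b₀ + b₀', ?_⟩
    rw [map_add, h, h', map_add, map_add, mul_add]
    abel
  | single i b =>
    rw [skewSum_single]
    induction i with
    | zero => exact ⟨0, b, by simp⟩
    | succ i ih =>
      obtain ⟨b₁, b₀, h⟩ := ih
      refine ⟨b₀ - a * b₁, -(a * b₁), ?_⟩
      rw [pow_succ', mul_assoc, h, mul_add, ← mul_assoc, hx]
      simp only [map_sub, map_neg, map_mul, sub_mul, neg_mul, mul_sub, mul_assoc]
      abel

theorem UT.coe_one_zero (M : UT) : (M : Matrix (Fin 2) (Fin 2) ℤ) 1 0 = 0 := M.2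

theorem UT.ext_iff (M N : UT) : M = N ↔
    (M : Matrix (Fin 2) (Fin 2) ℤ) 0 0 = (N : Matrix (Fin 2) (Fin 2) ℤ) 0 0 ∧
    (M : Matrix (Fin 2) (Fin 2) ℤ) 0 1 = (N : Matrix (Fin 2) (Fin 2) ℤ) 0 1 ∧
    (M : Matrix (Fin 2) (Fin 2) ℤ) 1 1 = (N : Matrix (Fin 2) (Fin 2) ℤ) 1 1 := by
  rw [Subtype.ext_iff, ← Matrix.ext_iff]
  simp [Fin.forall_fin_two, UT.coe_one_zero, and_assoc]

/-- The upper triangular matrix `[[p, q], [0, r]]`. -/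
def UT.mk (p q r : ℤ) : UT := ⟨!![p, q; 0, r], by show (!![p, q; 0, r]) 1 0 = 0; simp⟩

theorem UT.exists_eq_mk (M : UT) : ∃ p q r, M = UT.mk p q r :=
  ⟨_, _, _, (UT.ext_iff M (UT.mk _ _ _)).2 ⟨rfl, rfl, rfl⟩⟩

theorem UT.mk_inj {p q r p' q' r' : ℤ} :
    UT.mk p q r = UT.mk p' q' r' ↔ p = p' ∧ q = q' ∧ r = r' := by
  simp [UT.mk, and_assoc]

theorem UT.mk_mul (p q r p' q' r' : ℤ) :
    UT.mk p q r * UT.mk p' q' r' = UT.mk (p * p') (p * q' + q * r') (r * r') := by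
  simp [UT.mk]

theorem UT.mk_add (p q r p' q' r' : ℤ) :
    UT.mk p q r + UT.mk p' q' r' = UT.mk (p + p') (q + q') (r + r') := by
  simp [UT.mk]

theorem UT.mk_sub (p q r p' q' r' : ℤ) :
    UT.mk p q r - UT.mk p' q' r' = UT.mk (p - p') (q - q') (r - r') := by
  simp [UT.ext_iff, UT.mk]

theorem UT.one_eq_mk : (1 : UT) = UT.mk 1 0 1 := by
  simp [UT.ext_iff, UT.mk]

theorem UT.zero_eq_mk : (0 : UT) = UT.mk 0 0 0 := by
  simp [UT.ext_iff, UT.mk]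

theorem Dut_mk (p q r : ℤ) : Dut (UT.mk p q r) = UT.mk 0 q 0 := rfl

theorem aUT_eq_mk : aUT = UT.mk 3 0 1 := rfl

section Quotient

variable {A : Type*} [Ring A] {j : UT →+* A} {x : A}

/-- Elements of the centralizer of `UT` in `A` are `x n + diag (q + n, q)`. -/
theorem exists_of_mem_centralizer
    (hcomm : ∀ α : UT, j α * x = x * j α + j (Dut α))
    (hlin : ∀ z : A, ∃ b₁ b₀ : UT, z = x * j b₁ + j b₀)
    (hzero : ∀ b₁ b₀ : UT, x * j b₁ + j b₀ = 0 → b₁ = 0 ∧ b₀ = 0)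
    {u : A} (hu : ∀ α : UT, j α * u = u * j α) :
    ∃ n q : ℤ, u = x * j (UT.mk n 0 n) + j (UT.mk (q + n) 0 q) := by
  obtain ⟨b₁, b₀, rfl⟩ := hlin u
  have key : ∀ α : UT, α * b₁ - b₁ * α = 0 ∧ Dut α * b₁ + α * b₀ - b₀ * α = 0 := by
    intro α
    apply hzero
    have h := sub_eq_zero.2 (hu α)
    rw [mul_add, ← mul_assoc, hcomm] at h
    rw [← h]
    simp only [map_sub, map_add, map_mul, mul_sub, add_mul, mul_assoc]
    abel
  obtain ⟨p, r, s, rfl⟩ := UT.exists_eq_mk b₁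
  obtain ⟨p', r', s', rfl⟩ := UT.exists_eq_mk b₀
  have h₁ := key (UT.mk 1 0 0)
  have h₂ := key (UT.mk 0 1 0)
  simp only [Dut_mk, UT.mk_mul, UT.mk_add, UT.mk_sub, UT.zero_eq_mk, UT.mk_inj] at h₁ h₂
  refine ⟨s, s', ?_⟩
  have hb₁ : UT.mk p r s = UT.mk s 0 s := UT.mk_inj.2 (by omega)
  have hb₀ : UT.mk p' r' s' = UT.mk (s' + s) 0 s' := UT.mk_inj.2 (by omega)
  rw [hb₁, hb₀]

theorem trace_eq_of_centralizer
    (hcomm : ∀ α : UT, j α * x = x * j α + j (Dut α))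
    (hx : x * x = -(x * j aUT) - j aUT) (n q : ℤ) :
    (x + j aUT) * (x * j (UT.mk n 0 n) + j (UT.mk (q + n) 0 q)) +
        (x * j (UT.mk n 0 n) + j (UT.mk (q + n) 0 q)) * x =
      x * j (UT.mk (2 * q - n) 0 (2 * q - n)) +
        j (UT.mk (3 * (q - n)) 0 (q - 2 * n)) := by
  have hdiag : ∀ p r : ℤ, j (UT.mk p 0 r) * x = x * j (UT.mk p 0 r) := fun p r => by
    rw [hcomm, Dut_mk, ← UT.zero_eq_mk, map_zero, add_zero]
  have ha : j aUT * x = x * j aUT := hdiag 3 1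
  have h₁ : UT.mk (2 * q - n) 0 (2 * q - n) =
      UT.mk (q + n) 0 q + UT.mk (q + n) 0 q - aUT * UT.mk n 0 n := by
    simp only [aUT_eq_mk, UT.mk_mul, UT.mk_add, UT.mk_sub, UT.mk_inj]
    omega
  have h₀ : UT.mk (3 * (q - n)) 0 (q - 2 * n) =
      aUT * UT.mk (q + n) 0 q - aUT * UT.mk n 0 n - aUT * UT.mk n 0 n := by
    simp only [aUT_eq_mk, UT.mk_mul, UT.mk_sub, UT.mk_inj]
    omega
  have hxx : ∀ b : A, x * (x * b) = -(x * (j aUT * b)) - j aUT * b := fun b => by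
    rw [← mul_assoc, hx, sub_mul, neg_mul, mul_assoc]
  have hax : ∀ b : A, j aUT * (x * b) = x * (j aUT * b) := fun b => by
    rw [← mul_assoc, ha, mul_assoc]
  rw [h₁, h₀]
  simp only [map_sub, map_add, map_mul, mul_add, add_mul, mul_sub, mul_assoc, hdiag, hxx, hax]
  abel

theorem linear_mem_center
    (hcomm : ∀ α : UT, j α * x = x * j α + j (Dut α))
    (hlin : ∀ z : A, ∃ b₁ b₀ : UT, z = x * j b₁ + j b₀) (m s : ℤ) (w : A) :
    (x * j (UT.mk m 0 m) + j (UT.mk (s + m) 0 s)) * w =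
      w * (x * j (UT.mk m 0 m) + j (UT.mk (s + m) 0 s)) := by
  have hdiag : ∀ p r : ℤ, Commute (j (UT.mk p 0 r)) x := fun p r => by
    rw [commute_iff_eq, hcomm, Dut_mk, ← UT.zero_eq_mk, map_zero, add_zero]
  have hX : Commute (x * j (UT.mk m 0 m) + j (UT.mk (s + m) 0 s)) x :=
    ((Commute.refl x).mul_left (hdiag m m)).add_left (hdiag _ _)
  have hB : ∀ α : UT, Commute (x * j (UT.mk m 0 m) + j (UT.mk (s + m) 0 s)) (j α) := by
    intro α
    have h₁ : UT.mk m 0 m * α = α * UT.mk m 0 m := by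
      obtain ⟨p, q, r, rfl⟩ := UT.exists_eq_mk α
      simp only [UT.mk_mul, UT.mk_inj]
      refine ⟨?_, ?_, ?_⟩ <;> ring
    have h₀ : UT.mk (s + m) 0 s * α = Dut α * UT.mk m 0 m + α * UT.mk (s + m) 0 s := by
      obtain ⟨p, q, r, rfl⟩ := UT.exists_eq_mk α
      simp only [Dut_mk, UT.mk_mul, UT.mk_add, UT.mk_inj]
      refine ⟨?_, ?_, ?_⟩ <;> ring
    rw [commute_iff_eq, add_mul, mul_assoc, ← map_mul, ← map_mul, h₁, h₀, mul_add, ← mul_assoc,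
      hcomm]
    simp only [map_add, map_mul, add_mul, mul_assoc]
    abel
  obtain ⟨b₁, b₀, rfl⟩ := hlin w
  exact (hX.mul_right (hB b₁)).add_right (hB b₀)

end Quotient

/-- Let `B = UT` be the ring of 2×2 upper triangular integer matrices, `D` the derivation
sending `[[b₁,b₂],[0,b₃]]` to `[[0,b₂],[0,0]]`, `a = [[3,0],[0,1]]`, and
`f = X² + Xa + a` in `R = B[X;D]`, with `fR = Rf`, `A = R/fR`, `x = X + fR`, and
`τ(z) = (x + a)z + zx`.  Then `f` is not separable in `R`: there is no `u` in the
centralizer `V` of `B` in `A` with `τ(u) = 1`; equivalently, `τ(V)` is a proper subset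
of the center `C(A)` of `A`. -/
theorem stmt18 {R A : Type*} [Ring R] [Ring A]
    (ι : UT →+* R) (hι : Function.Injective ι) (X : R)
    (hcomm : ∀ α : UT, ι α * X = X * ι α + ι (Dut α))
    (hfree : ∀ r : R, ∃! c : ℕ →₀ UT, r = c.sum fun i b => X ^ i * ι b)
    (f : R) (hf : f = X ^ 2 + X * ι aUT + ι aUT)
    (htwo : (Set.range fun r => f * r) = Set.range fun r => r * f)
    (π : R →+* A) (hπ : Function.Surjective π)
    (hker : ∀ r : R, π r = 0 ↔ ∃ s, r = f * s)
    (τ : A → A)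
    (hτ : ∀ z : A, τ z = (π X + π (ι aUT)) * z + z * π X) :
    (¬ ∃ u : A, (∀ α : UT, π (ι α) * u = u * π (ι α)) ∧ τ u = 1) ∧
      τ '' {v : A | ∀ α : UT, π (ι α) * v = v * π (ι α)} ⊂
        {z : A | ∀ w : A, z * w = w * z} := by
  have hcommA : ∀ α : UT, π (ι α) * π X = π X * π (ι α) + π (ι (Dut α)) := fun α => by
    rw [← map_mul, hcomm, map_add, map_mul]
  have ha : Commute X (ι aUT) := by
    have h := hcomm aUT
    rw [aUT_eq_mk, Dut_mk, ← UT.zero_eq_mk, map_zero, add_zero] at h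
    exact h.symm
  have hx : π X * π X = -(π X * π (ι aUT)) - π (ι aUT) := by
    have h : π f = 0 := (hker f).2 ⟨1, (mul_one f).symm⟩
    rw [hf, map_add, map_add, map_mul, map_pow, pow_two] at h
    rw [← sub_eq_zero, ← h]
    abel
  have hlin : ∀ z : A, ∃ b₁ b₀ : UT, z = π X * (π.comp ι) b₁ + (π.comp ι) b₀ := by
    intro z
    obtain ⟨r, rfl⟩ := hπ z
    obtain ⟨c, hc, -⟩ := hfree r
    obtain ⟨b₁, b₀, h⟩ := exists_linear_of_skewSum (π.comp ι) (π X) aUT hx c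
    refine ⟨b₁, b₀, ?_⟩
    rw [← h, hc, skewSum_apply, map_finsuppSum]
    simp
  have hzero : ∀ b₁ b₀ : UT, π X * (π.comp ι) b₁ + (π.comp ι) b₀ = 0 → b₁ = 0 ∧ b₀ = 0 := by
    intro b₁ b₀ h
    obtain ⟨s, hs⟩ := (hker (X * ι b₁ + ι b₀)).1 (by simpa using h)
    rw [hf] at hs
    exact eq_zero_of_linear_eq_quadratic_mul ι X hfree aUT ha hs
  have hτV : ∀ u : A, (∀ α : UT, π (ι α) * u = u * π (ι α)) → ∃ n q : ℤ,
      τ u = π X * (π.comp ι) (UT.mk (2 * q - n) 0 (2 * q - n)) +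
        (π.comp ι) (UT.mk (3 * (q - n)) 0 (q - 2 * n)) := by
    intro u hu
    obtain ⟨n, q, rfl⟩ := exists_of_mem_centralizer (j := π.comp ι) hcommA hlin hzero hu
    exact ⟨n, q, by rw [hτ]; exact trace_eq_of_centralizer (j := π.comp ι) hcommA hx n q⟩
  have hnot : ¬ ∃ u : A, (∀ α : UT, π (ι α) * u = u * π (ι α)) ∧ τ u = 1 := by
    rintro ⟨u, hu, h⟩
    obtain ⟨n, q, hnq⟩ := hτV u hu
    obtain ⟨h₁, h₀⟩ := hzero (UT.mk (2 * q - n) 0 (2 * q - n))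
      (UT.mk (3 * (q - n)) 0 (q - 2 * n) - 1) (by
        rw [map_sub, map_one, ← add_sub_assoc, ← hnq, h, sub_self])
    rw [UT.one_eq_mk, UT.mk_sub, UT.zero_eq_mk, UT.mk_inj] at h₀
    rw [UT.zero_eq_mk, UT.mk_inj] at h₁
    omega
  refine ⟨hnot, ?_, fun hsub => ?_⟩
  · rintro _ ⟨v, hv, rfl⟩ w
    obtain ⟨n, q, hnq⟩ := hτV v hv
    have hs : 3 * (q - n) = (q - 2 * n) + (2 * q - n) := by ring
    rw [hnq, hs]
    exact linear_mem_center (j := π.comp ι) hcommA hlin _ _ w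
  · obtain ⟨u, hu, h⟩ := hsub (show (1 : A) ∈ {z : A | ∀ w : A, z * w = w * z} from
      fun w => by rw [one_mul, mul_one])
    exact hnot ⟨u, hu, h⟩
end
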